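/- (Main Theorem, reduction form.) Let M be a metric space, Leb a finite Borel measure on M, f : M → M a Borel measurable map, μ an f-invariant Borel probability measure on M, and r : M → ℝ a Borel measurable roof function with r(x) ≥ r₀ for all x, where r₀ > 0 is a constant, with ∫ r dμ < ∞ and ∫ r dLeb < ∞. Let ψ : M_r → ℝ be bounded measurable, set φ(x) = ∫_0^{r(x)} ψ(x,t) dt, and let λ be the measure on M_r given by λ(A) = ∫ ( ∫_0^{r(x)} χ_A(x,s) ds ) dLeb(x). Assume: (i) for every ε > 0, limsup_{n→∞} (1/n) log Leb{ x ∈ M : | (1/n) S_n φ(x) − ∫ φ dμ | > ε } < 0; (ii) for every ε > 0, limsup_{n→∞} (1/n) log Leb{ x ∈ M : | (1/n) S_n r(x) − ∫ r dμ | > ε } < 0; (iii) there exist constants C, γ > 0 such that ∫_{{x : r(x) > c}} r dLeb ≤ C e^{−γc} for every c > 0. Then for every ε > 0, limsup_{T→∞} (1/T) log λ{ z ∈ M_r : | (1/T) ∫_0^T ψ(X^t(z)) dt − (∫ φ dμ)/(∫ r dμ) | > ε } < 0. -/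

import Mathlib

open MeasureTheory Filter intervalIntegral
open scoped Topology ENNReal

/-- Birkhoff sum `S_n g(x) = ∑_{j=0}^{n-1} g(f^j x)`. -/
noncomputable def birkhoff {M : Type*} (f : M → M) (g : M → ℝ) (n : ℕ) (x : M) : ℝ :=
  ∑ j ∈ Finset.range n, g (f^[j] x)

/-- The lap number `n(x,s,T)`: the largest `n` with `S_n r(x) ≤ s + T`. -/
noncomputable def lap {M : Type*} (f : M → M) (r : M → ℝ) (x : M) (s T : ℝ) : ℕ :=
  sSup {n : ℕ | birkhoff f r n x ≤ s + T}

/-- The time-`T` map of the suspension semiflow: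
`X^T(x,s) = (f^n x, s + T - S_n r(x))` with `n = n(x,s,T)`. -/
noncomputable def suspFlow {M : Type*} (f : M → M) (r : M → ℝ) (T : ℝ) (z : M × ℝ) :
    M × ℝ :=
  (f^[lap f r z.1 z.2 T] z.1, z.2 + T - birkhoff f r (lap f r z.1 z.2 T) z.1)

/-- The suspension space `M_r = {(x,s) : 0 ≤ s < r x}`. -/
def suspSpace {M : Type*} (r : M → ℝ) : Set (M × ℝ) := {z | 0 ≤ z.2 ∧ z.2 < r z.1}

/-- The natural extension `λ = Leb ⋉ Leb¹` of a reference measure `Leb` on the base to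
the suspension space: `A ↦ ∫ (∫_0^{r x} χ_A(x,s) ds) dLeb(x)`. -/
noncomputable def suspMeasureAux {M : Type*} [MeasurableSpace M] (Leb : Measure M)
    (r : M → ℝ) : Measure (M × ℝ) :=
  Leb.bind fun x => (volume.restrict (Set.Ico (0 : ℝ) (r x))).map (Prod.mk x)

lemma sld_exp_of_limsup {u : ℕ → ℝ≥0∞}
    (h : limsup (fun n : ℕ => ENNReal.log (u n) / ((n : ℝ) : EReal)) atTop < 0) :
    ∃ c > (0 : ℝ), ∃ N : ℕ, ∀ n ≥ N, u n ≤ ENNReal.ofReal (Real.exp (-c * n)) := by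
  obtain ⟨y, hy1, hy2⟩ := EReal.lt_iff_exists_real_btwn.1 h
  have hy0 : y < 0 := by exact_mod_cast hy2
  have hev := eventually_lt_of_limsup_lt hy1
  obtain ⟨N, hN⟩ := eventually_atTop.1 (hev.and (eventually_gt_atTop 0))
  refine ⟨-y, by linarith, N, fun n hn => ?_⟩
  obtain ⟨h1, h2⟩ := hN n hn
  have hnpos : (0 : EReal) < ((n : ℝ) : EReal) := by exact_mod_cast h2
  rw [EReal.div_lt_iff hnpos (EReal.coe_ne_top _)] at h1
  rw [← ENNReal.log_le_log_iff, ENNReal.log_ofReal_of_pos (Real.exp_pos _), Real.log_exp]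
  rw [neg_neg, EReal.coe_mul]
  exact h1.le

lemma sld_limsup_of_exp {u : ℝ → ℝ≥0∞} {a K : ℝ} (ha : 0 < a)
    (h : ∀ᶠ T in atTop, u T ≤ ENNReal.ofReal (K * Real.exp (-a * T))) :
    limsup (fun T : ℝ => ENNReal.log (u T) / (T : EReal)) atTop < 0 := by
  have hlim : Tendsto (fun T : ℝ => Real.exp (a / 2 * T)) atTop atTop :=
    Real.tendsto_exp_atTop.comp (tendsto_id.const_mul_atTop (by linarith))
  have key : limsup (fun T : ℝ => ENNReal.log (u T) / (T : EReal)) atTop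
      ≤ ((-(a / 2) : ℝ) : EReal) := by
    refine limsup_le_of_le (h := ?_)
    filter_upwards [h, hlim.eventually_ge_atTop K, eventually_gt_atTop 0] with T h1 h2 h3
    rw [EReal.div_le_iff_le_mul (by exact_mod_cast h3) (EReal.coe_ne_top _), ← EReal.coe_mul]
    have h4 : u T ≤ ENNReal.ofReal (Real.exp (T * (-(a / 2)))) := by
      refine h1.trans (ENNReal.ofReal_le_ofReal ?_)
      calc K * Real.exp (-a * T) ≤ Real.exp (a / 2 * T) * Real.exp (-a * T) := by gcongr
        _ = Real.exp (T * (-(a / 2))) := by rw [← Real.exp_add]; congr 1; ring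
    have h5 := ENNReal.log_le_log h4
    rwa [ENNReal.log_ofReal_of_pos (Real.exp_pos _), Real.log_exp] at h5
  refine key.trans_lt ?_
  have : (-(a / 2) : ℝ) < 0 := by linarith
  exact_mod_cast this

lemma sld_union {M : Type*} [MeasurableSpace M] (ν : Measure M) (B : ℕ → Set M)
    (h : ∃ c > (0 : ℝ), ∃ N : ℕ, ∀ n ≥ N, ν (B n) ≤ ENNReal.ofReal (Real.exp (-c * n))) :
    ∃ c > (0 : ℝ), ∃ D ≥ (0 : ℝ), ∃ N : ℕ, ∀ m ≥ N,
      ν (⋃ k : ℕ, B (m + k)) ≤ ENNReal.ofReal (D * Real.exp (-c * m)) := by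
  obtain ⟨c, hc, N, hN⟩ := h
  have hlt : Real.exp (-c) < 1 := by simpa using hc
  refine ⟨c, hc, (1 - Real.exp (-c))⁻¹, inv_nonneg.2 (by linarith), N, fun m hm => ?_⟩
  have hs := hasSum_geometric_of_lt_one (Real.exp_pos (-c)).le hlt
  have hs2 := hs.mul_right (Real.exp (-c * m))
  calc ν (⋃ k : ℕ, B (m + k)) ≤ ∑' k, ν (B (m + k)) := measure_iUnion_le _
    _ ≤ ∑' k : ℕ, ENNReal.ofReal (Real.exp (-c) ^ k * Real.exp (-c * m)) := by
        refine ENNReal.tsum_le_tsum fun k => (hN (m + k) (by omega)).trans (le_of_eq ?_)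
        congr 1
        rw [← Real.exp_nat_mul, ← Real.exp_add]
        congr 1
        push_cast
        ring
    _ = ENNReal.ofReal ((1 - Real.exp (-c))⁻¹ * Real.exp (-c * m)) := by
        rw [← hs2.tsum_eq, ENNReal.ofReal_tsum_of_nonneg (fun k => by positivity) hs2.summable]

section flow
variable {M : Type*} {f : M → M} {r : M → ℝ} {r₀ : ℝ}

lemma sld_birk_succ (f : M → M) (r : M → ℝ) (n : ℕ) (x : M) :
    birkhoff f r (n + 1) x = birkhoff f r n x + r (f^[n] x) := by
  simp [birkhoff, Finset.sum_range_succ]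

lemma sld_birk_mono (hr₀ : 0 < r₀) (hr : ∀ x, r₀ ≤ r x) (x : M) :
    Monotone fun n => birkhoff f r n x := by
  refine monotone_nat_of_le_succ fun n => ?_
  rw [sld_birk_succ]
  linarith [hr (f^[n] x)]

lemma sld_birk_lower (hr : ∀ x, r₀ ≤ r x) (x : M) (n : ℕ) :
    n * r₀ ≤ birkhoff f r n x := by
  induction n with
  | zero => simp [birkhoff]
  | succ n ih =>
    rw [sld_birk_succ]
    push_cast
    linarith [hr (f^[n] x)]

lemma sld_bdd (hr₀ : 0 < r₀) (hr : ∀ x, r₀ ≤ r x) (x : M) (u : ℝ) :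
    BddAbove {n : ℕ | birkhoff f r n x ≤ u} := by
  refine ⟨⌈u / r₀⌉₊, fun n hn => ?_⟩
  have h1 := sld_birk_lower (f := f) hr x n
  have h2 : (n : ℝ) ≤ u / r₀ := by
    rw [le_div_iff₀ hr₀]
    exact h1.trans hn
  exact_mod_cast h2.trans (Nat.le_ceil _)

lemma sld_le_lap (hr₀ : 0 < r₀) (hr : ∀ x, r₀ ≤ r x) {x : M} {s T : ℝ} {n : ℕ}
    (h : birkhoff f r n x ≤ s + T) : n ≤ lap f r x s T :=
  le_csSup (sld_bdd hr₀ hr x _) h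

lemma sld_lap_spec (hr₀ : 0 < r₀) (hr : ∀ x, r₀ ≤ r x) {x : M} {s T : ℝ} (h : 0 ≤ s + T) :
    birkhoff f r (lap f r x s T) x ≤ s + T ∧ s + T < birkhoff f r (lap f r x s T + 1) x := by
  constructor
  · exact Nat.sSup_mem (s := {n : ℕ | birkhoff f r n x ≤ s + T})
      ⟨0, by simpa [birkhoff] using h⟩ (sld_bdd hr₀ hr x _)
  · by_contra! hc
    have := sld_le_lap hr₀ hr hc
    omega

lemma sld_lap_eq (hr₀ : 0 < r₀) (hr : ∀ x, r₀ ≤ r x) {x : M} {s T : ℝ} {n : ℕ}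
    (h1 : birkhoff f r n x ≤ s + T) (h2 : s + T < birkhoff f r (n + 1) x) :
    lap f r x s T = n := by
  have h0 : 0 ≤ s + T := by
    have := sld_birk_lower (f := f) hr x n
    have : (0 : ℝ) ≤ n * r₀ := by positivity
    linarith
  refine le_antisymm ?_ (sld_le_lap hr₀ hr h1)
  by_contra! hc
  have h3 := (sld_lap_spec (f := f) hr₀ hr (x := x) h0).1
  have h4 := sld_birk_mono (f := f) hr₀ hr x (show n + 1 ≤ lap f r x s T from hc)
  simp only at h4
  linarith

lemma sld_flow_integral [MeasurableSpace M] (hr₀ : 0 < r₀) (hr : ∀ x, r₀ ≤ r x)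
    {ψ : M × ℝ → ℝ} (hψm : Measurable ψ) {C₀ : ℝ} (hψb : ∀ z, |ψ z| ≤ C₀)
    {φ : M → ℝ} (hφ : ∀ x, φ x = ∫ t in (0 : ℝ)..(r x), ψ (x, t))
    (x : M) (n : ℕ) :
    IntervalIntegrable (fun u => ψ (suspFlow f r u (x, 0))) volume 0 (birkhoff f r n x) ∧
    ∫ u in (0 : ℝ)..birkhoff f r n x, ψ (suspFlow f r u (x, 0)) = birkhoff f φ n x := by
  induction n with
  | zero => simp [birkhoff]
  | succ n ih =>
    obtain ⟨ih1, ih2⟩ := ih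
    have hle : birkhoff f r n x ≤ birkhoff f r (n + 1) x := by
      rw [sld_birk_succ]; linarith [hr (f^[n] x)]
    set S := birkhoff f r n x with hS
    have heq : Set.EqOn (fun u => ψ (f^[n] x, u - S)) (fun u => ψ (suspFlow f r u (x, 0)))
        (Set.uIoo S (birkhoff f r (n + 1) x)) := by
      intro u hu
      rw [Set.uIoo_of_le hle] at hu
      have : lap f r x 0 u = n :=
        sld_lap_eq hr₀ hr (by rw [zero_add]; exact hu.1.le) (by rw [zero_add]; exact hu.2)
      simp only [suspFlow, this, zero_add, ← hS]
    have hm : Measurable (fun u : ℝ => ψ (f^[n] x, u - S)) := by fun_prop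
    have hint : IntervalIntegrable (fun u => ψ (f^[n] x, u - S)) volume S
        (birkhoff f r (n + 1) x) := by
      refine (intervalIntegrable_const (c := C₀)).mono_fun hm.aestronglyMeasurable ?_
      refine ae_of_all _ fun u => ?_
      simp only [Real.norm_eq_abs]
      exact (hψb _).trans (le_abs_self _)
    have hint2 := hint.congr_uIoo heq
    refine ⟨ih1.trans hint2, ?_⟩
    rw [← intervalIntegral.integral_add_adjacent_intervals ih1 hint2, ih2,
      ← intervalIntegral.integral_congr_uIoo heq, sld_birk_succ f φ, hφ (f^[n] x),
      intervalIntegral.integral_comp_sub_right (fun t => ψ (f^[n] x, t)), sld_birk_succ f r, ← hS]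
    simp

lemma sld_flow_bound [MeasurableSpace M] (hr₀ : 0 < r₀) (hr : ∀ x, r₀ ≤ r x)
    {ψ : M × ℝ → ℝ} (hψm : Measurable ψ) {C₀ : ℝ} (hψb : ∀ z, |ψ z| ≤ C₀)
    {φ : M → ℝ} (hφ : ∀ x, φ x = ∫ t in (0 : ℝ)..(r x), ψ (x, t))
    (x : M) {s T : ℝ} (hs : 0 ≤ s) (hT : 0 ≤ T) :
    |(∫ t in (0 : ℝ)..T, ψ (suspFlow f r t (x, s))) - birkhoff f φ (lap f r x s T) x|
      ≤ C₀ * (s + (s + T - birkhoff f r (lap f r x s T) x)) := by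
  obtain ⟨h1, h2⟩ := sld_lap_spec (f := f) hr₀ hr (x := x) (s := s) (T := T) (by linarith)
  set n := lap f r x s T
  set g : ℝ → ℝ := fun u => ψ (suspFlow f r u (x, 0)) with hg
  have hS0 : 0 ≤ birkhoff f r n x :=
    le_trans (by positivity) (sld_birk_lower (f := f) hr x n)
  have hfl : (∫ t in (0 : ℝ)..T, ψ (suspFlow f r t (x, s))) = ∫ u in s..(s + T), g u := by
    have := intervalIntegral.integral_comp_add_left (a := 0) (b := T) g s
    rw [add_zero] at this
    rw [← this]
    simp only [hg, suspFlow, lap, zero_add]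
  obtain ⟨hi, -⟩ := sld_flow_integral (f := f) hr₀ hr hψm hψb hφ x (n + 1)
  obtain ⟨-, he⟩ := sld_flow_integral (f := f) hr₀ hr hψm hψb hφ x n
  have hsub : ∀ a b : ℝ, 0 ≤ a → a ≤ s + T → 0 ≤ b → b ≤ s + T → IntervalIntegrable g volume a b := by
    intro a b ha ha' hb hb'
    refine hi.mono_set ?_
    rw [Set.uIcc_of_le (show (0 : ℝ) ≤ birkhoff f r (n + 1) x by linarith)]
    exact Set.uIcc_subset_Icc ⟨ha, by linarith⟩ ⟨hb, by linarith⟩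
  have hb : ∀ a b : ℝ, a ≤ b → |∫ u in a..b, g u| ≤ C₀ * (b - a) := by
    intro a b hab
    have := intervalIntegral.norm_integral_le_of_norm_le_const (a := a) (b := b) (f := g) (C := C₀)
      (fun u _ => hψb _)
    rwa [abs_of_nonneg (by linarith : 0 ≤ b - a)] at this
  have e1 := intervalIntegral.integral_add_adjacent_intervals
    (hsub 0 s le_rfl (by linarith) hs (by linarith))
    (hsub s (s + T) hs (by linarith) (by linarith) le_rfl)
  have e2 := intervalIntegral.integral_add_adjacent_intervals
    (hsub 0 _ le_rfl (by linarith) hS0 h1)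
    (hsub _ (s + T) hS0 h1 (by linarith) le_rfl)
  have b1 := abs_le.1 (hb 0 s hs)
  have b2 := abs_le.1 (hb _ (s + T) h1)
  rw [hfl]
  change (∫ u in (0 : ℝ)..birkhoff f r n x, g u) = _ at he
  rw [abs_le]
  constructor <;> linarith [b1.1, b1.2, b2.1, b2.2]

end flow

lemma sld_measure_bound {M : Type*} [MeasurableSpace M] (Leb : Measure M)
    (r : M → ℝ) (hrm : Measurable r) (hrpos : ∀ x, 0 ≤ r x) (hrLeb : Integrable r Leb)
    (E : Set M) {h : ℝ} (hh : 0 < h) (A : Set (M × ℝ))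
    (hA : ∀ z ∈ A, z ∈ suspSpace r ∧ (z.2 < h → z.1 ∈ E)) :
    suspMeasureAux Leb r A ≤ ENNReal.ofReal h * Leb E +
      ENNReal.ofReal (∫ x in {x : M | h < r x}, r x ∂Leb) := by
  have hEm := measurableSet_toMeasurable Leb E
  set F := toMeasurable Leb E
  have hRm : MeasurableSet {x : M | h < r x} := measurableSet_lt measurable_const hrm
  set B : Set (M × ℝ) := (F ×ˢ Set.Ico 0 h) ∪ {z | h ≤ z.2 ∧ z.2 < r z.1} with hB
  have hBm : MeasurableSet B := by
    refine (hEm.prod measurableSet_Ico).union ?_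
    exact (measurableSet_le measurable_const measurable_snd).inter
      (measurableSet_lt measurable_snd (hrm.comp measurable_fst))
  have hAB : A ⊆ B := by
    intro z hz
    obtain ⟨⟨h1, h2⟩, h3⟩ := hA z hz
    by_cases hc : z.2 < h
    · exact Or.inl ⟨subset_toMeasurable _ _ (h3 hc), h1, hc⟩
    · exact Or.inr ⟨not_lt.1 hc, h2⟩
  have hpt : ∀ x, ((volume.restrict (Set.Ico (0 : ℝ) (r x))).map (Prod.mk x)) B ≤
      F.indicator (fun _ => ENNReal.ofReal h) x +
        {x : M | h < r x}.indicator (fun x => ENNReal.ofReal (r x)) x := by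
    intro x
    rw [Measure.map_apply measurable_prodMk_left hBm]
    have : Prod.mk x ⁻¹' B = (Prod.mk x ⁻¹' (F ×ˢ Set.Ico 0 h)) ∪
      (Prod.mk x ⁻¹' {z : M × ℝ | h ≤ z.2 ∧ z.2 < r z.1}) := rfl
    rw [this]
    refine (measure_union_le _ _).trans (add_le_add ?_ ?_)
    · refine (Measure.restrict_apply_le _ _).trans ?_
      by_cases hx : x ∈ F
      · rw [Set.indicator_of_mem hx]
        have : Prod.mk x ⁻¹' (F ×ˢ Set.Ico 0 h) = Set.Ico 0 h := by
          ext s; simp [hx]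
        rw [this, Real.volume_Ico, sub_zero]
      · have : Prod.mk x ⁻¹' (F ×ˢ Set.Ico 0 h) = ∅ := by
          ext s; simp [hx]
        rw [this]; simp
    · refine (Measure.restrict_apply_le _ _).trans ?_
      by_cases hx : h < r x
      · rw [Set.indicator_of_mem (show x ∈ {x : M | h < r x} from hx)]
        have : Prod.mk x ⁻¹' {z : M × ℝ | h ≤ z.2 ∧ z.2 < r z.1} ⊆ Set.Ico 0 (r x) := by
          intro s hs
          exact ⟨hh.le.trans hs.1, hs.2⟩
        refine (measure_mono this).trans ?_
        rw [Real.volume_Ico, sub_zero]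
      · have : Prod.mk x ⁻¹' {z : M × ℝ | h ≤ z.2 ∧ z.2 < r z.1} = ∅ := by
          ext s
          simp only [Set.mem_preimage, Set.mem_ofPred_eq, Set.mem_empty_iff_false, iff_false]
          rintro ⟨a, b⟩
          exact hx (a.trans_lt b)
        rw [this]; simp
  calc suspMeasureAux Leb r A ≤ suspMeasureAux Leb r B := measure_mono hAB
    _ ≤ ∫⁻ x, ((volume.restrict (Set.Ico (0 : ℝ) (r x))).map (Prod.mk x)) B ∂Leb :=
        Measure.bind_apply_le _ hBm
    _ ≤ ∫⁻ x, (F.indicator (fun _ => ENNReal.ofReal h) x +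
        {x : M | h < r x}.indicator (fun x => ENNReal.ofReal (r x)) x) ∂Leb := lintegral_mono hpt
    _ = _ := by
        rw [lintegral_add_left (measurable_const.indicator hEm), lintegral_indicator hEm,
          lintegral_indicator hRm, setLIntegral_const, measure_toMeasurable,
          ofReal_integral_eq_lintegral_ofReal hrLeb.integrableOn (ae_of_all _ hrpos)]

/-- The deterministic estimate. -/
lemma sld_det {R Φ C₀ K δ T s Sn Sn1 P I n : ℝ} (hR : 0 < R) (hC : 0 ≤ C₀) (hδ : 0 < δ)
    (hδ1 : δ ≤ 1) (hnK : n ≤ K * T) (hs' : s ≤ δ * T)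
    (hI : |I - P| ≤ C₀ * (s + (s + T - Sn)))
    (h1 : |Sn - n * R| ≤ n * δ) (h2 : |Sn1 - (n + 1) * R| ≤ (n + 1) * δ)
    (h3 : |P - n * Φ| ≤ n * δ) (h4 : Sn ≤ s + T) (h5 : s + T < Sn1) (hs : 0 ≤ s) :
    |I - T * (Φ / R)| ≤ δ * T * (C₀ * (1 + 2 * K) + K + |Φ| / R * (1 + K)) +
      (C₀ + |Φ| / R) * (R + 1) := by
  have hnδ : n * δ ≤ K * T * δ := by gcongr
  have a1 := abs_le.1 h1
  have a2 := abs_le.1 h2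
  have b1 : s + (s + T - Sn) ≤ δ * T + (R + 1) + 2 * (K * T * δ) := by
    linarith [a1.1, a2.2]
  have b2 : |n * R - T| ≤ δ * T + K * T * δ + (R + 1) := by
    rw [abs_le]
    constructor <;> linarith [a1.1, a1.2, a2.1, a2.2]
  have b3 : |n * Φ - T * (Φ / R)| ≤ |Φ| / R * (δ * T + K * T * δ + (R + 1)) := by
    have : n * Φ - T * (Φ / R) = Φ / R * (n * R - T) := by field_simp
    rw [this, abs_mul, abs_div, abs_of_pos hR]
    gcongr
  have b4 : |I - P| ≤ C₀ * (δ * T + (R + 1) + 2 * (K * T * δ)) :=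
    hI.trans (by gcongr)
  have : I - T * (Φ / R) = (I - P) + (P - n * Φ) + (n * Φ - T * (Φ / R)) := by ring
  rw [this]
  refine (abs_add_three _ _ _).trans ?_
  linarith

set_option maxHeartbeats 2000000 in
/-- Main Theorem (reduction form): exponential large deviation bounds for the Birkhoff
sums of `φ(x) = ∫_0^{r x} ψ(x,t) dt` and of the roof function `r` over the base map,
together with an exponential tail estimate for `r` with respect to the reference measure,
imply an exponential large deviation upper bound for the time averages of `ψ` under the
suspension semiflow, with respect to the extended reference measure `λ = Leb ⋉ Leb¹`. -/
theorem suspension_large_deviations {M : Type*} [MetricSpace M] [MeasurableSpace M]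
    [BorelSpace M]
    (Leb : Measure M) [IsFiniteMeasure Leb]
    (f : M → M) (hf : Measurable f)
    (μ : Measure M) [IsProbabilityMeasure μ] (hinv : MeasurePreserving f μ μ)
    (r : M → ℝ) (hrm : Measurable r) (r₀ : ℝ) (hr₀ : 0 < r₀) (hr : ∀ x, r₀ ≤ r x)
    (hrμ : Integrable r μ) (hrLeb : Integrable r Leb)
    (ψ : M × ℝ → ℝ) (hψm : Measurable ψ) (C₀ : ℝ) (hψb : ∀ z, |ψ z| ≤ C₀)
    (φ : M → ℝ) (hφ : ∀ x, φ x = ∫ t in (0 : ℝ)..(r x), ψ (x, t))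
    -- (i) large deviations bound for `φ` over the base transformation
    (hldφ : ∀ ε > (0 : ℝ),
      limsup (fun n : ℕ =>
          ENNReal.log (Leb {x : M |
              ε < |(1 / (n : ℝ)) * birkhoff f φ n x - ∫ x, φ x ∂μ|}) / ((n : ℝ) : EReal))
        atTop < 0)
    -- (ii) large deviations bound for `r` over the base transformation
    (hldr : ∀ ε > (0 : ℝ),
      limsup (fun n : ℕ =>
          ENNReal.log (Leb {x : M |
              ε < |(1 / (n : ℝ)) * birkhoff f r n x - ∫ x, r x ∂μ|}) / ((n : ℝ) : EReal))
        atTop < 0)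
    -- (iii) exponential tail of the roof function w.r.t. the reference measure
    (htail : ∃ C > (0 : ℝ), ∃ γ > (0 : ℝ), ∀ c > (0 : ℝ),
      ∫ x in {x : M | c < r x}, r x ∂Leb ≤ C * Real.exp (-γ * c)) :
    ∀ ε > (0 : ℝ),
      limsup (fun T : ℝ =>
          ENNReal.log (suspMeasureAux Leb r {z : M × ℝ | z ∈ suspSpace r ∧
              ε < |(1 / T) * (∫ t in (0 : ℝ)..T, ψ (suspFlow f r t z)) -
                    (∫ x, φ x ∂μ) / ∫ x, r x ∂μ|}) / (T : EReal))
        atTop < 0 := by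
  intro ε hε
  obtain ⟨C, hC, γ, hγ, htail⟩ := htail
  set R := ∫ x, r x ∂μ with hRdef
  set Φ := ∫ x, φ x ∂μ with hΦdef
  have hR : 0 < R := by
    have : ∫ _, r₀ ∂μ ≤ R := integral_mono (integrable_const _) hrμ hr
    simp at this
    linarith
  have hMne : Nonempty M := μ.nonempty_of_neZero
  have hC₀ : 0 ≤ C₀ := (abs_nonneg _).trans (hψb (hMne.some, 0))
  set K := 2 / r₀ with hK
  have hKpos : 0 < K := by positivity
  set A := C₀ * (1 + 2 * K) + K + |Φ| / R * (1 + K) with hA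
  have hApos : 0 < A := by positivity
  set B := (C₀ + |Φ| / R) * (R + 1) with hB
  obtain ⟨δ, hδ, hδ1, hδR, hδA⟩ : ∃ δ > (0 : ℝ), δ ≤ 1 ∧ δ ≤ R ∧ δ * A ≤ ε / 2 := by
    refine ⟨min 1 (min R (ε / (2 * A))), by positivity, min_le_left _ _,
      (min_le_right _ _).trans (min_le_left _ _), ?_⟩
    calc min 1 (min R (ε / (2 * A))) * A ≤ (ε / (2 * A)) * A := by
          gcongr
          exact (min_le_right _ _).trans (min_le_right _ _)
      _ = ε / 2 := by field_simp
  obtain ⟨c₁, hc₁, D₁, hD₁, N₁, hN₁⟩ := sld_union Leb _ (sld_exp_of_limsup (hldφ δ hδ))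
  obtain ⟨c₂, hc₂, D₂, hD₂, N₂, hN₂⟩ := sld_union Leb _ (sld_exp_of_limsup (hldr δ hδ))
  set b := min c₁ c₂ with hb
  have hbpos : 0 < b := lt_min hc₁ hc₂
  set a := min (b / (4 * R)) (γ * δ) with ha
  have hapos : 0 < a := by positivity
  set q := b / (4 * R) with hq
  have hqpos : 0 < q := by positivity
  refine sld_limsup_of_exp (a := a)
    (K := δ * (1 / q) * ((D₁ + D₂) * Real.exp b) + C) hapos ?_
  filter_upwards [eventually_ge_atTop 1, eventually_ge_atTop (2 * B / ε),
    eventually_ge_atTop (2 * R * (N₁ + N₂ + 1))] with T hT1 hTB hTN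
  have hTpos : 0 < T := by linarith
  set m := ⌊T / (2 * R)⌋₊ with hm
  have hm1 : (m : ℝ) ≤ T / (2 * R) := Nat.floor_le (by positivity)
  have hm2 : T / (2 * R) < m + 1 := Nat.lt_floor_add_one _
  have hmN : N₁ + N₂ ≤ m := by
    refine Nat.le_floor ?_
    rw [le_div_iff₀ (by positivity)]
    push_cast
    nlinarith
  specialize hN₁ m (by omega)
  specialize hN₂ m (by omega)
  set E₁ := ⋃ k : ℕ, {x : M |
    δ < |(1 / ((m + k : ℕ) : ℝ)) * birkhoff f φ (m + k) x - Φ|} with hE₁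
  set E₂ := ⋃ k : ℕ, {x : M |
    δ < |(1 / ((m + k : ℕ) : ℝ)) * birkhoff f r (m + k) x - R|} with hE₂
  have good : ∀ (g : M → ℝ) (G : ℝ) (x : M),
      x ∉ (⋃ k : ℕ, {x : M | δ < |(1 / ((m + k : ℕ) : ℝ)) * birkhoff f g (m + k) x - G|}) →
      ∀ n ≥ m, |birkhoff f g n x - n * G| ≤ n * δ := by
    intro g G x hx n hn
    rcases Nat.eq_zero_or_pos n with h0 | h0
    · simp [h0, birkhoff]
    · obtain ⟨k, rfl⟩ := Nat.exists_eq_add_of_le hn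
      simp only [Set.mem_iUnion, Set.mem_ofPred_eq, not_exists, not_lt] at hx
      have hk := hx k
      have hp : (0 : ℝ) < ((m + k : ℕ) : ℝ) := by exact_mod_cast h0
      have : birkhoff f g (m + k) x - ((m + k : ℕ) : ℝ) * G =
          ((m + k : ℕ) : ℝ) * ((1 / ((m + k : ℕ) : ℝ)) * birkhoff f g (m + k) x - G) := by
        field_simp
      rw [this, abs_mul, abs_of_pos hp]
      gcongr
  have hbound := sld_measure_bound Leb r hrm (fun x => hr₀.le.trans (hr x)) hrLeb (E₁ ∪ E₂)
    (h := δ * T) (by positivity) {z : M × ℝ | z ∈ suspSpace r ∧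
              ε < |(1 / T) * (∫ t in (0 : ℝ)..T, ψ (suspFlow f r t z)) - Φ / R|} (by
    rintro ⟨x, s⟩ ⟨hz, hdev⟩
    refine ⟨hz, fun hsT => ?_⟩
    by_contra hx
    simp only [Set.mem_union, not_or] at hx hsT
    have hs : 0 ≤ s := hz.1
    have gφ := good φ Φ x hx.1
    have gr := good r R x hx.2
    obtain ⟨l1, l2⟩ := sld_lap_spec (f := f) hr₀ hr (x := x) (s := s) (T := T) (by linarith)
    have hfb := sld_flow_bound (f := f) hr₀ hr hψm hψb hφ x hs hTpos.le
    have hml : m ≤ lap f r x s T := by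
      refine sld_le_lap hr₀ hr ?_
      have h1 := (abs_le.1 (gr m le_rfl)).2
      have h2 : (m : ℝ) * δ ≤ m * R := by gcongr
      rw [le_div_iff₀ (by positivity)] at hm1
      linarith
    set n := lap f r x s T
    have hnK : (n : ℝ) ≤ K * T := by
      have h1 := sld_birk_lower (f := f) hr x n
      have h2 : δ * T ≤ 1 * T := by gcongr
      rw [hK, div_mul_eq_mul_div, le_div_iff₀ hr₀]
      linarith
    have g2 := gr (n + 1) (by omega)
    push_cast at g2
    have hdet := sld_det hR hC₀ hδ hδ1 hnK hsT.le hfb (gr n hml) g2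
      (gφ n hml) l1 l2 hs
    rw [← hA, ← hB] at hdet
    have hfin : (1 / T) * (∫ t in (0 : ℝ)..T, ψ (suspFlow f r t (x, s))) - Φ / R =
        (1 / T) * ((∫ t in (0 : ℝ)..T, ψ (suspFlow f r t (x, s))) - T * (Φ / R)) := by
      field_simp
    rw [hfin, abs_mul, abs_of_pos (by positivity : 0 < 1 / T), one_div, inv_mul_eq_div,
      lt_div_iff₀ hTpos] at hdev
    rw [div_le_iff₀ hε] at hTB
    have : δ * A * T ≤ ε / 2 * T := by gcongr
    nlinarith)
  refine hbound.trans ?_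
  have hE : Leb (E₁ ∪ E₂) ≤ ENNReal.ofReal ((D₁ + D₂) * Real.exp (-b * m)) := by
    refine (measure_union_le _ _).trans ((add_le_add hN₁ hN₂).trans ?_)
    rw [← ENNReal.ofReal_add (by positivity) (by positivity)]
    refine ENNReal.ofReal_le_ofReal ?_
    rw [add_mul]
    have e1 : -c₁ * (m : ℝ) ≤ -b * m := by
      have : b * m ≤ c₁ * m := by gcongr; exact min_le_left _ _
      linarith
    have e2 : -c₂ * (m : ℝ) ≤ -b * m := by
      have : b * m ≤ c₂ * m := by gcongr; exact min_le_right _ _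
      linarith
    gcongr
  have hexp : Real.exp (-b * m) ≤ Real.exp b * Real.exp (-(2 * q) * T) := by
    rw [← Real.exp_add]
    refine Real.exp_le_exp.2 ?_
    have : b * (T / (2 * R)) ≤ b * (m + 1) := by gcongr
    have h2 : 2 * q * T = b * (T / (2 * R)) := by rw [hq]; ring
    linarith
  have hTexp : T ≤ 1 / q * Real.exp (q * T) := by
    have := Real.add_one_le_exp (q * T)
    rw [one_div, inv_mul_eq_div, le_div_iff₀ hqpos]
    linarith
  have hqa : Real.exp (-q * T) ≤ Real.exp (-a * T) := by
    refine Real.exp_le_exp.2 ?_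
    have : a * T ≤ q * T := by gcongr; exact min_le_left _ _
    linarith
  have hga : Real.exp (-γ * (δ * T)) ≤ Real.exp (-a * T) := by
    refine Real.exp_le_exp.2 ?_
    have : a * T ≤ γ * δ * T := by gcongr; exact min_le_right _ _
    linarith
  calc ENNReal.ofReal (δ * T) * Leb (E₁ ∪ E₂) +
        ENNReal.ofReal (∫ x in {x : M | δ * T < r x}, r x ∂Leb)
      ≤ ENNReal.ofReal (δ * T) * ENNReal.ofReal ((D₁ + D₂) * Real.exp (-b * m)) +
        ENNReal.ofReal (C * Real.exp (-γ * (δ * T))) := by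
        gcongr
        exact htail _ (by positivity)
    _ = ENNReal.ofReal (δ * T * ((D₁ + D₂) * Real.exp (-b * m)) +
          C * Real.exp (-γ * (δ * T))) := by
        rw [← ENNReal.ofReal_mul (by positivity), ← ENNReal.ofReal_add (by positivity)
          (by positivity)]
    _ ≤ _ := by
        refine ENNReal.ofReal_le_ofReal ?_
        rw [add_mul _ C]
        refine add_le_add ?_ (mul_le_mul_of_nonneg_left hga hC.le)
        calc δ * T * ((D₁ + D₂) * Real.exp (-b * m))
            ≤ δ * (1 / q * Real.exp (q * T)) *
              ((D₁ + D₂) * (Real.exp b * Real.exp (-(2 * q) * T))) := by gcongr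
          _ = δ * (1 / q) * ((D₁ + D₂) * Real.exp b) *
              (Real.exp (q * T) * Real.exp (-(2 * q) * T)) := by ring
          _ = δ * (1 / q) * ((D₁ + D₂) * Real.exp b) * Real.exp (-q * T) := by
              rw [← Real.exp_add]; congr 2; ring
          _ ≤ _ := by gcongr
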